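/- Y is connected im kleinen at every cut point other than (1,0): for every x ∈ Y such that Y \ {x} is not connected and x ≠ (1,0), and for every open neighborhood U of x in Y, there exists a connected subset C ⊆ U with x in the interior of C relative to Y. -/

import Mathlib

open Set

/-- The `n`-th hair of the broom: `H n = {(t, t/2^n) : t ∈ [0,1]}`. -/
def hair (n : ℕ) : Set (ℝ × ℝ) := {p | ∃ t ∈ Icc (0:ℝ) 1, p = (t, t / 2 ^ n)}

/-- The Closed Infinite Broom `B = ([0,1] × {0}) ∪ ⋃ₙ H n`. -/
def broom : Set (ℝ × ℝ) := (Icc (0:ℝ) 1 ×ˢ ({0} : Set ℝ)) ∪ ⋃ n, hair n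

/-- The range space `Y = B ∪ ([1,2] × {0})`. -/
def Yset : Set (ℝ × ℝ) := broom ∪ (Icc (1:ℝ) 2 ×ˢ ({0} : Set ℝ))

lemma one_zero_mem_Yset : ((1:ℝ), (0:ℝ)) ∈ Yset := Or.inr ⟨by norm_num, by norm_num⟩

/-- The point `(1,0)` of `Y`. -/
noncomputable def p₁₀ : ↥Yset := ⟨((1:ℝ), (0:ℝ)), one_zero_mem_Yset⟩

lemma convex_hair (n : ℕ) : Convex ℝ (hair n) := by
  rintro _ ⟨s, hs, rfl⟩ _ ⟨t, ht, rfl⟩ a b ha hb hab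
  refine ⟨a * s + b * t, convex_Icc (0 : ℝ) 1 hs ht ha hb hab, ?_⟩
  ext
  · simp
  · simp
    ring

lemma zero_mem_hair (n : ℕ) : (0 : ℝ × ℝ) ∈ hair n :=
  ⟨0, by norm_num, by ext <;> simp⟩

lemma starConvex_iUnion_hair : StarConvex ℝ 0 (⋃ n, hair n) :=
  starConvex_iUnion fun n ↦ (convex_hair n).starConvex (zero_mem_hair n)

lemma starConvex_broom : StarConvex ℝ 0 broom :=
  (((convex_Icc (0 : ℝ) 1).prod (convex_singleton (0 : ℝ))).starConvex
    ⟨by norm_num, mem_singleton _⟩).union starConvex_iUnion_hair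

lemma broom_subset_closure_iUnion_hair : broom ⊆ closure (⋃ n, hair n) := by
  refine union_subset ?_ subset_closure
  rintro ⟨s, y⟩ ⟨hs, rfl : y = 0⟩
  have hlim : Filter.Tendsto (fun n : ℕ ↦ (s, s / 2 ^ n)) Filter.atTop (nhds (s, (0 : ℝ))) := by
    refine tendsto_const_nhds.prodMk_nhds ?_
    have h := (tendsto_pow_atTop_nhds_zero_of_lt_one (r := (1 / 2 : ℝ))
      (by norm_num) (by norm_num)).const_mul s
    simpa [div_eq_mul_inv] using h
  exact mem_closure_of_tendsto hlim
    (Filter.Eventually.of_forall fun n ↦ mem_iUnion.2 ⟨n, s, hs, rfl⟩)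

lemma isConnected_image_val_iff {X : Type*} [TopologicalSpace X] {Y : Set X} {C : Set Y} :
    IsConnected (Subtype.val '' C) ↔ IsConnected C :=
  image_nonempty.and Topology.IsInducing.subtypeVal.isPreconnected_image

/-- A point of the open bottom edge of the broom is not a cut point of `Y`. -/
lemma isConnected_compl_singleton_of_bottom {t : ℝ} (ht : t ∈ Ioo (0 : ℝ) 1) {x : Yset}
    (hx : (x : ℝ × ℝ) = (t, 0)) : IsConnected ({x}ᶜ : Set Yset) := by
  have hhair : (⋃ n, hair n) ⊆ broom \ {(t, 0)} := by
    refine subset_sdiff_singleton subset_union_right fun h ↦ ?_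
    obtain ⟨n, s, -, hs⟩ := mem_iUnion.1 h
    obtain ⟨rfl, h0⟩ := Prod.mk.inj hs
    have : 0 < t / 2 ^ n := div_pos ht.1 (by positivity)
    exact this.ne h0
  have hbroom : IsPreconnected (broom \ {(t, 0)}) :=
    (starConvex_iUnion_hair.isPathConnected
      (mem_iUnion.2 ⟨0, zero_mem_hair 0⟩)).isConnected.isPreconnected.subset_closure hhair
      (sdiff_subset.trans broom_subset_closure_iUnion_hair)
  have hedge : IsPreconnected (Icc (1 : ℝ) 2 ×ˢ ({0} : Set ℝ)) :=
    isPreconnected_Icc.prod isPreconnected_singleton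
  have hone : ((1 : ℝ), (0 : ℝ)) ∈ broom \ {(t, 0)} :=
    ⟨Or.inl ⟨by norm_num, rfl⟩, fun h ↦ ht.2.ne' (Prod.mk.inj h).1⟩
  have himage : Subtype.val '' ({x}ᶜ : Set Yset) =
      broom \ {(t, 0)} ∪ Icc (1 : ℝ) 2 ×ˢ ({0} : Set ℝ) := by
    have hnot : ((t, 0) : ℝ × ℝ) ∉ Icc (1 : ℝ) 2 ×ˢ ({0} : Set ℝ) :=
      fun h ↦ ht.2.not_ge h.1.1
    rw [image_compl_eq_range_sdiff_image Subtype.val_injective, Subtype.range_coe,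
      image_singleton, hx, Yset, union_sdiff_distrib, sdiff_singleton_eq_self hnot]
  rw [← isConnected_image_val_iff, himage]
  exact ⟨⟨_, Or.inl hone⟩, hbroom.union (1, 0) hone ⟨by norm_num, rfl⟩ hedge⟩

/-- A subspace which near `x` coincides with a set star convex at `x` is connected im kleinen
at `x`. -/
lemma exists_isConnected_subset_of_starConvex {E : Type*} [NormedAddCommGroup E]
    [NormedSpace ℝ E] {Y K V : Set E} {x : Y} (hK : StarConvex ℝ (x : E) K) (hKY : K ⊆ Y)
    (hV : IsOpen V) (hxV : (x : E) ∈ V) (hYV : Y ∩ V ⊆ K) {U : Set Y} (hU : IsOpen U)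
    (hxU : x ∈ U) : ∃ C : Set Y, C ⊆ U ∧ IsConnected C ∧ x ∈ interior C := by
  obtain ⟨O, hO, rfl⟩ := isOpen_induced_iff.1 hU
  obtain ⟨r, hr, hball⟩ := Metric.isOpen_iff.1 (hO.inter hV) x ⟨hxU, hxV⟩
  have hxr : (x : E) ∈ Metric.ball (x : E) r := Metric.mem_ball_self hr
  refine ⟨Subtype.val ⁻¹' (K ∩ Metric.ball (x : E) r), fun y hy ↦ (hball hy.2).1, ?_, ?_⟩
  · rw [← isConnected_image_val_iff, Subtype.image_preimage_coe,
      inter_eq_right.2 (inter_subset_left.trans hKY)]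
    exact ((hK.inter ((convex_ball (x : E) r).starConvex hxr)).isPathConnected
      ⟨hYV ⟨x.2, hxV⟩, hxr⟩).isConnected
  · refine mem_interior.2 ⟨Subtype.val ⁻¹' Metric.ball (x : E) r, fun y hy ↦ ?_,
      Metric.isOpen_ball.preimage continuous_subtype_val, hxr⟩
    exact ⟨hYV ⟨y.2, (hball hy).2⟩, hy⟩

/-- The open sector around the `n`-th hair meets `Y` only in that hair. -/
lemma Yset_inter_sector_subset_hair (n : ℕ) :
    Yset ∩ {p | 0 < p.1 ∧ p.1 / 2 ^ (n + 1) < p.2 ∧ p.2 < 2 * p.1 / 2 ^ n} ⊆ hair n := by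
  rintro ⟨a, b⟩ ⟨hY, ha, hlow, hupp⟩
  simp only at ha hlow hupp
  have hb : 0 < b := lt_trans (by positivity) hlow
  rcases hY with (⟨-, h0⟩ | h) | ⟨-, h0⟩
  · exact (hb.ne' h0).elim
  · obtain ⟨m, s, hs, hp⟩ := mem_iUnion.1 h
    obtain ⟨rfl, rfl⟩ := Prod.mk.inj hp
    have hmn : m < n + 1 := by
      rw [div_lt_div_iff_of_pos_left ha (by positivity) (by positivity)] at hlow
      exact (pow_lt_pow_iff_right₀ one_lt_two).1 hlow
    have hnm : n < m + 1 := by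
      rw [div_lt_div_iff₀ (by positivity) (by positivity), mul_comm 2 a, mul_assoc,
        mul_lt_mul_iff_right₀ ha, ← pow_succ'] at hupp
      exact (pow_lt_pow_iff_right₀ one_lt_two).1 hupp
    obtain rfl : m = n := by omega
    exact ⟨a, hs, rfl⟩
  · exact (hb.ne' h0).elim

/-- `Y` is connected im kleinen at every cut point other than `(1,0)`: if `x ∈ Y`
is a cut point (`Y \ {x}` is not connected) and `x ≠ (1,0)`, then for every open
neighbourhood `U` of `x` there is a connected set `C ⊆ U` with `x` in the
interior of `C`. -/
theorem im_kleinen_at_other_cutpoints :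
    ∀ x : ↥Yset, ¬ IsConnected ({x}ᶜ : Set ↥Yset) → x ≠ p₁₀ →
      ∀ U : Set ↥Yset, IsOpen U → x ∈ U →
        ∃ C : Set ↥Yset, C ⊆ U ∧ IsConnected C ∧ x ∈ interior C := by
  rintro ⟨⟨a, b⟩, hY⟩ hcut hne U hU hxU
  have origin (h : ((a, b) : ℝ × ℝ) = 0) :
      ∃ C : Set ↥Yset, C ⊆ U ∧ IsConnected C ∧ ⟨(a, b), hY⟩ ∈ interior C := by
    refine exists_isConnected_subset_of_starConvex (K := broom) (V := {p | p.1 < 1})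
      (by simpa only [h] using starConvex_broom) subset_union_left
      (isOpen_lt continuous_fst continuous_const) (by simp [h]) ?_ hU hxU
    rintro p ⟨hp | hp, hp1⟩
    · exact hp
    · exact absurd hp.1.1 (not_le.2 hp1)
  rcases id hY with (⟨ha, rfl : b = 0⟩ | h) | ⟨ha, rfl : b = 0⟩
  · rcases ha.1.eq_or_lt with rfl | h0
    · exact origin rfl
    rcases ha.2.eq_or_lt with rfl | h1
    · exact absurd rfl hne
    exact absurd (isConnected_compl_singleton_of_bottom ⟨h0, h1⟩ rfl) hcut
  · obtain ⟨n, t, ht, hp⟩ := mem_iUnion.1 h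
    obtain ⟨rfl, rfl⟩ := Prod.mk.inj hp
    rcases ht.1.eq_or_lt with rfl | h0
    · exact origin (by ext <;> simp)
    refine exists_isConnected_subset_of_starConvex
      ((convex_hair n).starConvex ⟨a, ht, rfl⟩)
      ((subset_iUnion hair n).trans (subset_union_right.trans subset_union_left))
      ?_ ?_ (Yset_inter_sector_subset_hair n) hU hxU
    · exact (isOpen_lt continuous_const continuous_fst).inter
        ((isOpen_lt (by fun_prop) continuous_snd).inter (isOpen_lt continuous_snd (by fun_prop)))
    · refine ⟨h0, ?_, ?_⟩
      · exact div_lt_div_of_pos_left h0 (by positivity) (pow_lt_pow_right₀ one_lt_two n.lt_succ_self)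
      · exact div_lt_div_of_pos_right (by linarith) (by positivity)
  · rcases ha.1.eq_or_lt with rfl | h1
    · exact absurd rfl hne
    refine exists_isConnected_subset_of_starConvex (K := Icc (1 : ℝ) 2 ×ˢ ({0} : Set ℝ))
      (V := {p | 1 < p.1}) (x := ⟨(a, 0), hY⟩)
      (((convex_Icc (1 : ℝ) 2).prod (convex_singleton (0 : ℝ))).starConvex
        ⟨ha, mem_singleton _⟩)
      subset_union_right (isOpen_lt continuous_const continuous_fst) h1 ?_ hU hxU
    rintro p ⟨(hp | hp) | hp, hp1⟩
    · exact absurd hp.1.2 (not_le.2 hp1)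
    · obtain ⟨n, t, ht, rfl⟩ := mem_iUnion.1 hp
      exact absurd ht.2 (not_le.2 hp1)
    · exact hp
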